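/- For every λ ∈ (0,1) and every α with 0 < α ≤ (1−λ)/(12+4λ), there exist constants c_3, c_4 > 0, depending only on λ and α, with the following property: for every nonempty finite CNN request sequence σ' whose last request is r' = r(x',y') and every extension σ'' = σ', r(x'',y'') with Δx = |x'−x''| ≥ Δy = |y'−y''| such that G_{W_{σ''}} attains its infimum over M³, one has inf G_{W_{σ''}} − inf G_{W_{σ'}} ≥ c_3·∇ − c_4·Δy, where ∇ = sup_{s∈M} Sl_{W_{σ'}}(s; r(x'',y'')). -/

import Mathlib

noncomputable section

/-- The L1 metric on `ℝ²` (the CNN metric space). -/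
def dL1 (p q : ℝ × ℝ) : ℝ := |p.1 - q.1| + |p.2 - q.2|

/-- The CNN request associated with a point `(x, y)`. -/
def req (p : ℝ × ℝ) : Set (ℝ × ℝ) := {q | q.1 = p.1 ∨ q.2 = p.2}

/-- The work function of a finite CNN request sequence (requests listed in order of arrival),
starting at origin `O`. -/
noncomputable def WF (O : ℝ × ℝ) : List (ℝ × ℝ) → (ℝ × ℝ) → ℝ
  | [], s => dL1 O s
  | p :: l, s => sInf ((fun t => dL1 O t + WF t l s) '' req p)

/-- The slack of a point `s` to a nonempty set `C` with respect to `W`. -/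
noncomputable def Sl (lam : ℝ) (W : ℝ × ℝ → ℝ) (s : ℝ × ℝ) (C : Set (ℝ × ℝ)) : ℝ :=
  sInf ((fun t => W t + lam * dL1 t s) '' C) - W s

/-- The rectangle spanned by two points of `ℝ²`. -/
def Boks (s1 s2 : ℝ × ℝ) : Set (ℝ × ℝ) :=
  {p | p.1 ∈ Set.uIcc s1.1 s2.1 ∧ p.2 ∈ Set.uIcc s1.2 s2.2}

/-- `H_W(s₁,s₂) = (1/2)W(s₁) + (1/2)W(s₂) − (λ/2)d(s₁,s₂)`. -/
noncomputable def Hf (lam : ℝ) (W : ℝ × ℝ → ℝ) (s1 s2 : ℝ × ℝ) : ℝ :=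
  (1 / 2) * W s1 + (1 / 2) * W s2 - (lam / 2) * dL1 s1 s2

/-- `G_W(s₁,s₂,s₃) = H_W(s₁,s₂) − α·Sl_W(s₃;Boks(s₁,s₂))`. -/
noncomputable def Gf (lam α : ℝ) (W : ℝ × ℝ → ℝ) (s1 s2 s3 : ℝ × ℝ) : ℝ :=
  Hf lam W s1 s2 - α * Sl lam W s3 (Boks s1 s2)

/-- `inf_{M³} G_W`. -/
noncomputable def infG (lam α : ℝ) (W : ℝ × ℝ → ℝ) : ℝ :=
  sInf (Set.range fun q : (ℝ × ℝ) × (ℝ × ℝ) × (ℝ × ℝ) => Gf lam α W q.1 q.2.1 q.2.2)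


lemma dL1_nonneg (p q : ℝ × ℝ) : 0 ≤ dL1 p q := by unfold dL1; positivity

lemma dL1_comm (p q : ℝ × ℝ) : dL1 p q = dL1 q p := by
  unfold dL1; rw [abs_sub_comm p.1, abs_sub_comm p.2]

lemma dL1_tri (p q r : ℝ × ℝ) : dL1 p r ≤ dL1 p q + dL1 q r := by
  unfold dL1
  have := abs_sub_le p.1 q.1 r.1
  have := abs_sub_le p.2 q.2 r.2
  linarith

lemma req_nonempty (p : ℝ × ℝ) : (req p).Nonempty := ⟨p, Or.inl rfl⟩

lemma WF_ge (l : List (ℝ × ℝ)) : ∀ O s, dL1 O s ≤ WF O l s := by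
  induction l with
  | nil => intro O s; exact le_rfl
  | cons p l ih =>
    intro O s
    refine le_csInf ((req_nonempty p).image _) ?_
    rintro _ ⟨t, -, rfl⟩
    have := ih t s
    have := dL1_tri O t s
    simp only
    linarith

lemma WF_bdd (O s p : ℝ × ℝ) (l : List (ℝ × ℝ)) :
    BddBelow ((fun t => dL1 O t + WF t l s) '' req p) := by
  refine ⟨0, ?_⟩
  rintro _ ⟨t, -, rfl⟩
  have := WF_ge l t s
  have := dL1_nonneg t s
  have := dL1_nonneg O t
  simp only
  linarith

lemma WF_cons_le {O s p t : ℝ × ℝ} {l : List (ℝ × ℝ)} (ht : t ∈ req p) :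
    WF O (p :: l) s ≤ dL1 O t + WF t l s :=
  csInf_le (WF_bdd O s p l) ⟨t, ht, rfl⟩

lemma le_WF_cons {O s p : ℝ × ℝ} {l : List (ℝ × ℝ)} {c : ℝ}
    (h : ∀ t ∈ req p, c ≤ dL1 O t + WF t l s) : c ≤ WF O (p :: l) s := by
  refine le_csInf ((req_nonempty p).image _) ?_
  rintro _ ⟨t, ht, rfl⟩
  exact h t ht

lemma WF_lip (l : List (ℝ × ℝ)) : ∀ O s t, WF O l s ≤ WF O l t + dL1 t s := by
  induction l with
  | nil => intro O s t; exact dL1_tri O t s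
  | cons p l ih =>
    intro O s t
    rw [← sub_le_iff_le_add]
    refine le_WF_cons fun u hu => ?_
    have := WF_cons_le (O := O) (s := s) (l := l) hu
    have := ih u s t
    linarith

/-- Upper bound half of the recursion at the end of the sequence. -/
lemma WF_snoc_le (l : List (ℝ × ℝ)) (p s t : ℝ × ℝ) (ht : t ∈ req p) :
    ∀ O, WF O (l ++ [p]) s ≤ WF O l t + dL1 t s := by
  induction l with
  | nil => intro O; exact WF_cons_le ht
  | cons q l ih =>
    intro O
    rw [← sub_le_iff_le_add]
    refine le_WF_cons fun u hu => ?_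
    have h1 := WF_cons_le (O := O) (s := s) (l := l ++ [p]) hu
    have := ih u
    simp only [List.cons_append]
    linarith

/-- Lower bound half of the recursion at the end of the sequence. -/
lemma le_WF_snoc (l : List (ℝ × ℝ)) (p s : ℝ × ℝ) :
    ∀ O c, (∀ t ∈ req p, c ≤ WF O l t + dL1 t s) → c ≤ WF O (l ++ [p]) s := by
  induction l with
  | nil => intro O c h; exact le_WF_cons h
  | cons q l ih =>
    intro O c h
    refine le_WF_cons fun u hu => ?_
    have := ih u (c - dL1 O u) (fun t ht => by
      have := h t ht
      have := WF_cons_le (O := O) (s := t) (l := l) hu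
      linarith)
    change c ≤ dL1 O u + WF u (l ++ [p]) s
    linarith

lemma continuous_dL1 (s : ℝ × ℝ) : Continuous fun t => dL1 t s := by
  unfold dL1; fun_prop

lemma continuous_of_lip {W : ℝ × ℝ → ℝ} (hL : ∀ s t, W s ≤ W t + dL1 t s) : Continuous W := by
  rw [continuous_iff_continuousAt]
  intro s
  have h : Filter.Tendsto (fun t => dL1 t s) (nhds s) (nhds 0) := by
    have := (continuous_dL1 s).tendsto s
    simpa [dL1] using this
  rw [ContinuousAt, tendsto_iff_dist_tendsto_zero]
  refine squeeze_zero (fun _ => dist_nonneg) (fun t => ?_) h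
  rw [Real.dist_eq, abs_le]
  have h1 := hL s t
  have h2 := hL t s
  rw [dL1_comm s t] at h2
  constructor <;> linarith

lemma req_closed (p : ℝ × ℝ) : IsClosed (req p) := by
  have : req p = {q | q.1 = p.1} ∪ {q | q.2 = p.2} := rfl
  rw [this]
  exact (isClosed_eq continuous_fst continuous_const).union
    (isClosed_eq continuous_snd continuous_const)

lemma exists_min (p O : ℝ × ℝ) {f : ℝ × ℝ → ℝ} (hf : Continuous f)
    (hge : ∀ t, dL1 O t ≤ f t) : ∃ t ∈ req p, ∀ u ∈ req p, f t ≤ f u := by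
  have hp : p ∈ req p := Or.inl rfl
  refine hf.continuousOn.exists_isMinOn' (req_closed p) hp ?_
  apply Filter.Eventually.filter_mono inf_le_left
  have hc : (Metric.closedBall O (f p))ᶜ ∈ Filter.cocompact (ℝ × ℝ) :=
    (isCompact_closedBall O (f p)).compl_mem_cocompact
  filter_upwards [hc] with t ht
  have h1 := hge t
  have h2 : f p < dist t O := by simpa using ht
  have h3 : dist t O ≤ dL1 O t := by
    rw [Prod.dist_eq, dL1, Real.dist_eq, Real.dist_eq, abs_sub_comm O.1, abs_sub_comm O.2]
    exact max_le (by linarith [abs_nonneg (t.2 - O.2)]) (by linarith [abs_nonneg (t.1 - O.1)])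
  linarith

lemma WF_snoc_attain (O : ℝ × ℝ) (l : List (ℝ × ℝ)) (p s : ℝ × ℝ) :
    ∃ t ∈ req p, WF O l t + dL1 t s ≤ WF O (l ++ [p]) s := by
  obtain ⟨t, ht, h⟩ := exists_min p O (f := fun t => WF O l t + dL1 t s)
    ((continuous_of_lip (WF_lip l O)).add (continuous_dL1 s))
    (fun t => by have := WF_ge l O t; have := dL1_nonneg t s; linarith)
  exact ⟨t, ht, le_WF_snoc l p s O _ h⟩

section slack
variable {lam : ℝ} {W : ℝ × ℝ → ℝ}

lemma Sl_le (h0 : 0 < lam) (hW : ∀ s, 0 ≤ W s) {s t : ℝ × ℝ} {C : Set (ℝ × ℝ)} (ht : t ∈ C) :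
    Sl lam W s C ≤ W t + lam * dL1 t s - W s := by
  unfold Sl
  have : sInf ((fun t => W t + lam * dL1 t s) '' C) ≤ W t + lam * dL1 t s := by
    refine csInf_le ⟨0, ?_⟩ ⟨t, ht, rfl⟩
    rintro _ ⟨u, -, rfl⟩
    have := hW u
    have := mul_nonneg h0.le (dL1_nonneg u s)
    simp only
    linarith
  linarith

lemma le_Sl {s : ℝ × ℝ} {C : Set (ℝ × ℝ)} (hC : C.Nonempty) {c : ℝ}
    (h : ∀ t ∈ C, c ≤ W t + lam * dL1 t s - W s) : c ≤ Sl lam W s C := by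
  unfold Sl
  have : c + W s ≤ sInf ((fun t => W t + lam * dL1 t s) '' C) := by
    refine le_csInf (hC.image _) ?_
    rintro _ ⟨u, hu, rfl⟩
    have := h u hu
    simp only
    linarith
  linarith

end slack

lemma Boks_left (s1 s2 : ℝ × ℝ) : s1 ∈ Boks s1 s2 := ⟨Set.left_mem_uIcc, Set.left_mem_uIcc⟩
lemma Boks_right (s1 s2 : ℝ × ℝ) : s2 ∈ Boks s1 s2 := ⟨Set.right_mem_uIcc, Set.right_mem_uIcc⟩
lemma Boks_comm (s1 s2 : ℝ × ℝ) : Boks s1 s2 = Boks s2 s1 := by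
  unfold Boks; rw [Set.uIcc_comm s1.1, Set.uIcc_comm s1.2]

lemma Gf_comm (lam α : ℝ) (W : ℝ × ℝ → ℝ) (s1 s2 s3 : ℝ × ℝ) :
    Gf lam α W s1 s2 s3 = Gf lam α W s2 s1 s3 := by
  unfold Gf Hf; rw [Boks_comm, dL1_comm]; ring

lemma alpha_bound {lam α : ℝ} (h0 : 0 < lam) (hα1 : α ≤ (1 - lam) / (12 + 4 * lam)) :
    α * (12 + 4 * lam) ≤ 1 - lam := by
  rwa [le_div_iff₀ (by linarith)] at hα1

lemma Gf_nonneg {lam α : ℝ} (h0 : 0 < lam) (h1 : lam < 1)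
    (hα0 : 0 < α) (hα1 : α * (12 + 4 * lam) ≤ 1 - lam) {W : ℝ × ℝ → ℝ} {O : ℝ × ℝ}
    (hge : ∀ s, dL1 O s ≤ W s) (s1 s2 s3 : ℝ × ℝ) : 0 ≤ Gf lam α W s1 s2 s3 := by
  have hW : ∀ s, 0 ≤ W s := fun s => (dL1_nonneg O s).trans (hge s)
  have hS := Sl_le h0 hW (s := s3) (Boks_left s1 s2)
  have t1 := dL1_tri s1 O s2
  have t2 := dL1_tri s1 O s3
  rw [dL1_comm s1 O] at t1 t2
  have t1' := mul_le_mul_of_nonneg_left t1 h0.le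
  have t2' := mul_le_mul_of_nonneg_left t2 h0.le
  have g1 := mul_le_mul_of_nonneg_left (hge s1) h0.le
  have g2 := mul_le_mul_of_nonneg_left (hge s2) h0.le
  have g3 := mul_le_mul_of_nonneg_left (hge s3) h0.le
  have w1 := mul_nonneg (sub_nonneg.2 h1.le) (hW s1)
  have w2 := mul_nonneg (sub_nonneg.2 h1.le) (hW s2)
  have w3 := mul_nonneg (sub_nonneg.2 h1.le) (hW s3)
  have hS2 : Sl lam W s3 (Boks s1 s2) ≤ (1 + lam) * W s1 := by linarith
  have hS3 := mul_le_mul_of_nonneg_left hS2 hα0.le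
  have hc : α * (1 + lam) ≤ (1 - lam) / 2 := by nlinarith
  have hc2 := mul_le_mul_of_nonneg_right hc (hW s1)
  unfold Gf Hf
  linarith

/-- A retraction of `uIcc a' b` to `uIcc a b`. -/
lemma uIcc_move {a a' b x : ℝ} (hx : x ∈ Set.uIcc a' b) :
    ∃ z ∈ Set.uIcc a b, |z - x| ≤ |a - a'| := by
  rw [Set.mem_uIcc] at hx
  simp only [Set.mem_uIcc]
  rcases le_total a b with hab | hab
  · rcases le_total x a with h | h
    · exact ⟨a, Or.inl ⟨le_rfl, hab⟩, by
        rcases hx with hx | hx <;> rw [abs_le] <;> constructor <;>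
          linarith [le_abs_self (a - a'), neg_abs_le (a - a'), abs_nonneg (a-a')]⟩
    · rcases le_total x b with h' | h'
      · exact ⟨x, Or.inl ⟨h, h'⟩, by simp⟩
      · exact ⟨b, Or.inl ⟨hab, le_rfl⟩, by
          rcases hx with hx | hx <;> rw [abs_le] <;> constructor <;>
            linarith [le_abs_self (a - a'), neg_abs_le (a - a'), abs_nonneg (a-a')]⟩
  · rcases le_total a x with h | h
    · exact ⟨a, Or.inr ⟨hab, le_rfl⟩, by
        rcases hx with hx | hx <;> rw [abs_le] <;> constructor <;>
          linarith [le_abs_self (a - a'), neg_abs_le (a - a'), abs_nonneg (a-a')]⟩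
    · rcases le_total b x with h' | h'
      · exact ⟨x, Or.inr ⟨h', h⟩, by simp⟩
      · exact ⟨b, Or.inr ⟨le_rfl, hab⟩, by
          rcases hx with hx | hx <;> rw [abs_le] <;> constructor <;>
            linarith [le_abs_self (a - a'), neg_abs_le (a - a'), abs_nonneg (a-a')]⟩

section main
variable {lam α : ℝ} {W V : ℝ × ℝ → ℝ} {x' y' x'' y'' : ℝ}

/-- Lemma C, first step: get rid of `s3` on a horizontal line. -/
lemma horiz_step (h0 : 0 < lam) (hα0 : 0 < α) (hα2 : α ≤ 1 / 2) (hW : ∀ s, 0 ≤ W s)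
    (a1 a2 a3 y : ℝ) (h12 : a1 ≤ a2) :
    ∃ b1 b2 : ℝ, Hf lam W (b1, y) (b2, y) ≤ Gf lam α W (a1, y) (a2, y) (a3, y) := by
  by_cases hS : Sl lam W (a3, y) (Boks (a1, y) (a2, y)) ≤ 0
  · refine ⟨a1, a2, ?_⟩
    have := mul_nonneg hα0.le (neg_nonneg.2 hS)
    unfold Gf; linarith
  push Not at hS
  have hm := mul_le_mul_of_nonneg_right hα2 hS.le
  rcases lt_or_ge a3 a1 with h | h
  · refine ⟨a3, a2, ?_⟩
    have := Sl_le h0 hW (s := (a3, y)) (Boks_left (a1, y) (a2, y))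
    unfold Gf Hf
    simp only [dL1, sub_self, abs_zero, add_zero] at this ⊢
    rw [abs_of_nonneg (by linarith)] at this
    rw [abs_of_nonpos (by linarith), abs_of_nonpos (by linarith)]
    linarith
  rcases lt_or_ge a2 a3 with h' | h'
  · refine ⟨a1, a3, ?_⟩
    have := Sl_le h0 hW (s := (a3, y)) (Boks_right (a1, y) (a2, y))
    unfold Gf Hf
    simp only [dL1, sub_self, abs_zero, add_zero] at this ⊢
    rw [abs_of_nonpos (by linarith)] at this
    rw [abs_of_nonpos (by linarith), abs_of_nonpos (by linarith)]
    linarith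
  · exfalso
    have : Sl lam W (a3, y) (Boks (a1, y) (a2, y)) ≤ _ := Sl_le h0 hW (t := (a3, y))
      ⟨by simpa [Set.mem_uIcc] using Or.inl ⟨h, h'⟩, by simp⟩
    simp [dL1] at this
    linarith

lemma horiz_case (h0 : 0 < lam) (hα0 : 0 < α) (hα2 : α ≤ 1 / 2) (hW : ∀ s, 0 ≤ W s)
    (a1 a2 a3 : ℝ) (p : ℝ × ℝ) :
    ∃ t1 t2 t3, Gf lam α W t1 t2 t3 ≤
      Gf lam α W (a1, y'') (a2, y'') (a3, y'') - α * Sl lam W p (req (x'', y'')) := by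
  have key : ∃ b1 b2 : ℝ, Hf lam W (b1, y'') (b2, y'') ≤
      Gf lam α W (a1, y'') (a2, y'') (a3, y'') := by
    rcases le_total a1 a2 with h | h
    · exact horiz_step h0 hα0 hα2 hW a1 a2 a3 y'' h
    · rw [Gf_comm]
      exact horiz_step h0 hα0 hα2 hW a2 a1 a3 y'' h
  obtain ⟨b1, b2, hb⟩ := key
  refine ⟨(b1, y''), (b2, y''), p, ?_⟩
  have : Sl lam W p (req (x'', y'')) ≤ Sl lam W p (Boks (b1, y'') (b2, y'')) := by
    refine le_Sl ⟨_, Boks_left _ _⟩ fun t ht => Sl_le h0 hW (Or.inr ?_)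
    simpa using ht.2
  have := mul_le_mul_of_nonneg_left this hα0.le
  unfold Gf at hb ⊢
  linarith

/-- Case A: `s1` is supported by the old vertical line. -/
lemma caseA (h0 : 0 < lam) (h1 : lam < 1) (hα0 : 0 < α)
    (hα1 : α * (12 + 4 * lam) ≤ 1 - lam) (hV0 : ∀ s, 0 ≤ V s)
    (hWL : ∀ s t, W s ≤ W t + dL1 t s) (hWV : ∀ s, W s ≤ V s)
    (hVW : ∀ s, V s ≤ W s + 2 * |x' - x''|) (s1 s2 s3 : ℝ × ℝ)
    (hs : W (x', s1.2) + |x' - x''| + |s1.1 - x''| ≤ V s1) :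
    ∃ t1 t2 t3, Gf lam α W t1 t2 t3 ≤ Gf lam α V s1 s2 s3 - (1 - lam) / 4 * |x' - x''| := by
  refine ⟨(x', s1.2), s2, s3, ?_⟩
  set D := |x' - x''|
  set e := |s1.1 - x''|
  have hD : 0 ≤ D := abs_nonneg _
  have he : 0 ≤ e := abs_nonneg _
  have hde : |s1.1 - x'| ≤ D + e := by
    have := abs_sub_le s1.1 x'' x'
    rw [abs_sub_comm x'' x'] at this
    linarith
  have hS : Sl lam V s3 (Boks s1 s2) - (3 + lam) * (D + e) ≤
      Sl lam W s3 (Boks (x', s1.2) s2) := by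
    refine le_Sl ⟨_, Boks_left _ _⟩ fun q hq => ?_
    obtain ⟨z, hz, hzq⟩ := uIcc_move (a := s1.1) hq.1
    have hmem : (z, q.2) ∈ Boks s1 s2 := ⟨hz, hq.2⟩
    have k1 := Sl_le h0 hV0 (s := s3) hmem
    have k2 := hVW (z, q.2)
    have k3 := hWL (z, q.2) q
    have k4 : dL1 q (z, q.2) ≤ D + e := by
      simp only [dL1, sub_self, abs_zero, add_zero]
      rw [abs_sub_comm]
      exact hzq.trans hde
    have k5 := dL1_tri (z, q.2) q s3
    rw [dL1_comm (z, q.2) q] at k5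
    have k6 := mul_le_mul_of_nonneg_left (k5.trans (add_le_add_left k4 _)) h0.le
    have k7 := hWV s3
    nlinarith
  have hd : dL1 s1 s2 ≤ dL1 (x', s1.2) s2 + (D + e) := by
    have := dL1_tri s1 (x', s1.2) s2
    have h' : dL1 s1 (x', s1.2) ≤ D + e := by
      simpa [dL1] using hde
    linarith
  have hd' := mul_le_mul_of_nonneg_left hd h0.le
  have hS' := mul_le_mul_of_nonneg_left hS hα0.le
  have hw2 := hWV s2
  have hα' := mul_le_mul_of_nonneg_right hα1 (add_nonneg hD he)
  have hle := mul_nonneg (sub_nonneg.2 h1.le) he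
  unfold Gf Hf
  linarith

/-- Cases B and C share the replacement of `s1`, `s2` by points on the horizontal line. -/
lemma caseBC (h0 : 0 < lam) (hα0 : 0 < α)
    (hα1 : α * (12 + 4 * lam) ≤ 1 - lam) (hV0 : ∀ s, 0 ≤ V s)
    (hVW : ∀ (s : ℝ × ℝ), V s ≤ W (s.1, y'') + |s.2 - y''|) {δ : ℝ} (s1 s2 s3 t3 : ℝ × ℝ)
    (hs1 : W (s1.1, y'') + |s1.2 - y''| - 2 * δ ≤ V s1)
    (hs2 : W (s2.1, y'') + |s2.2 - y''| - 2 * δ ≤ V s2) (c : ℝ)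
    (h3 : W t3 + lam * dL1 t3 s3 + c ≤ V s3) :
    Gf lam α W (s1.1, y'') (s2.1, y'') t3 ≤ Gf lam α V s1 s2 s3 + 2 * δ - α * c := by
  set e1 := |s1.2 - y''|
  set e2 := |s2.2 - y''|
  have he1 : 0 ≤ e1 := abs_nonneg _
  have he2 : 0 ≤ e2 := abs_nonneg _
  have hS : Sl lam V s3 (Boks s1 s2) - (1 + lam) * e1 + c ≤
      Sl lam W t3 (Boks (s1.1, y'') (s2.1, y'')) := by
    refine le_Sl ⟨_, Boks_left _ _⟩ fun q hq => ?_
    have hq2 : q.2 = y'' := by simpa using hq.2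
    have hmem : (q.1, s1.2) ∈ Boks s1 s2 := ⟨hq.1, Set.left_mem_uIcc⟩
    have k1 := Sl_le h0 hV0 (s := s3) hmem
    have k2 := hVW (q.1, s1.2)
    have k3 : ((q.1, y'') : ℝ × ℝ) = q := by rw [← hq2]
    simp only [k3] at k2
    have k4 : dL1 (q.1, s1.2) q = e1 := by
      simp only [dL1, sub_self, abs_zero, zero_add, hq2]; rfl
    have k5 := dL1_tri (q.1, s1.2) q s3
    have k6 := dL1_tri q t3 s3
    have k7 := mul_le_mul_of_nonneg_left (k5.trans (add_le_add_right k6 _)) h0.le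
    rw [k4] at k7
    have k8 : |s1.2 - y''| = e1 := rfl
    rw [k8] at k2
    linarith
  have hd : dL1 s1 s2 ≤ dL1 (s1.1, y'') (s2.1, y'') + e1 + e2 := by
    have := abs_sub_le s1.2 y'' s2.2
    rw [abs_sub_comm y'' s2.2] at this
    simp only [dL1, sub_self, abs_zero]
    linarith
  have hd' := mul_le_mul_of_nonneg_left hd h0.le
  have hS' := mul_le_mul_of_nonneg_left hS hα0.le
  have hc : α * (1 + lam) ≤ (1 - lam) / 2 := by nlinarith
  have hc1 := mul_le_mul_of_nonneg_right hc he1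
  have hl : 0 ≤ 1 - lam := le_trans (by positivity) hα1
  have hc2 := mul_nonneg hl he2
  unfold Gf Hf
  linarith

/-- The core estimate. -/
lemma core (h0 : 0 < lam) (h1 : lam < 1) (hα0 : 0 < α)
    (hα1 : α * (12 + 4 * lam) ≤ 1 - lam)
    (hW0 : ∀ s, 0 ≤ W s) (hWL : ∀ s t, W s ≤ W t + dL1 t s)
    (hWs : ∀ s, ∃ t ∈ req (x', y'), W t + dL1 t s ≤ W s)
    (hVle : ∀ s, ∀ t ∈ req (x'', y''), V s ≤ W t + dL1 t s)
    (hVs : ∀ s, ∃ t ∈ req (x'', y''), W t + dL1 t s ≤ V s)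
    (hxy : |y' - y''| ≤ |x' - x''|) (s1 s2 s3 p : ℝ × ℝ)
    (hp : 0 ≤ Sl lam W p (req (x'', y''))) :
    ∃ t1 t2 t3, Gf lam α W t1 t2 t3 ≤ Gf lam α V s1 s2 s3
      - α * (1 - lam) / (1 + lam) * Sl lam W p (req (x'', y'')) + 4 * |y' - y''| := by
  set D := |x' - x''| with hDdef
  set δ := |y' - y''| with hδdef
  have hD : 0 ≤ D := abs_nonneg _
  have hδ : 0 ≤ δ := abs_nonneg _
  have hα2 : α ≤ 1 / 2 := by nlinarith
  have hWV : ∀ s, W s ≤ V s := fun s => by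
    obtain ⟨t, -, ht⟩ := hVs s
    exact (hWL s t).trans ht
  have hV0 : ∀ s, 0 ≤ V s := fun s => (hW0 s).trans (hWV s)
  -- decomposition of `W`
  have hWdec : ∀ s : ℝ × ℝ, W (s.1, y'') + |s.2 - y''| - 2 * δ ≤ W s ∨
      W (x', s.2) + |s.1 - x'| ≤ W s := by
    intro s
    obtain ⟨⟨a, b⟩, ht | ht, h⟩ := hWs s
    · right
      have h2 := hWL (x', s.2) (a, b)
      simp only at ht
      subst ht
      simp only [dL1, sub_self, abs_zero, zero_add] at h h2
      rw [abs_sub_comm s.1]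
      linarith
    · left
      have h2 := hWL (s.1, y'') (a, b)
      simp only at ht
      subst ht
      simp only [dL1] at h h2
      have := abs_sub_le s.2 b y''
      rw [abs_sub_comm s.2 b] at this
      linarith
  have hVH : ∀ s : ℝ × ℝ, V s ≤ W (s.1, y'') + |s.2 - y''| := fun s => by
    have := hVle s (s.1, y'') (Or.inr rfl)
    simpa [dL1, abs_sub_comm] using this
  have hVV : ∀ s : ℝ × ℝ, V s ≤ W (x', s.2) + D + |s.1 - x''| := fun s => by
    have h1 := hVle s (x'', s.2) (Or.inl rfl)
    have h2 := hWL (x'', s.2) (x', s.2)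
    simp only [dL1, sub_self, abs_zero, add_zero] at h1 h2
    rw [abs_sub_comm s.1]
    linarith
  have hVdec : ∀ s : ℝ × ℝ, W (s.1, y'') + |s.2 - y''| - 2 * δ ≤ V s ∨
      W (x', s.2) + D + |s.1 - x''| ≤ V s := by
    intro s
    obtain ⟨⟨a, b⟩, ht | ht, h⟩ := hVs s
    · simp only at ht
      subst ht
      rcases hWdec (a, b) with h2 | h2
      · left
        have h3 := hWL (s.1, y'') (a, y'')
        have := abs_sub_le s.2 b y''
        rw [abs_sub_comm s.2 b] at this
        simp only [dL1, sub_self, abs_zero, add_zero] at h h2 h3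
        linarith
      · right
        have h3 := hWL (x', s.2) (x', b)
        rw [abs_sub_comm s.1, hDdef, abs_sub_comm x']
        simp only [dL1, sub_self, abs_zero, zero_add] at h h2 h3
        linarith
    · left
      simp only at ht
      subst ht
      have h3 := hWL (s.1, b) (a, b)
      rw [abs_sub_comm s.2]
      simp only [dL1, sub_self, abs_zero, add_zero] at h h3
      linarith
  have hVW : ∀ s, V s ≤ W s + 2 * D := by
    intro s
    rcases hWdec s with h | h
    · have := hVH s
      linarith
    · have := hVV s
      have := abs_sub_le s.1 x' x''
      linarith
  -- the slack is at most `(1 + λ) D`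
  have hN : Sl lam W p (req (x'', y'')) ≤ (1 + lam) * D := by
    obtain ⟨⟨a, b⟩, ht | ht, h⟩ := hWs p
    · simp only at ht
      subst ht
      have k1 := Sl_le h0 hW0 (s := p) (t := (x'', p.2)) (C := req (x'', y'')) (Or.inl rfl)
      have k2 := hWL (x'', p.2) (a, p.2)
      have k3 := hWL (a, p.2) (a, b)
      have k4 := abs_sub_le x'' a p.1
      rw [abs_sub_comm x'' a] at k4
      have k5 := mul_le_mul_of_nonneg_left k4 h0.le
      have k6 := mul_le_mul_of_nonneg_right h1.le (abs_nonneg (a - p.1))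
      simp only [dL1, sub_self, abs_zero, zero_add, add_zero] at h k1 k2 k3
      linarith
    · simp only at ht
      subst ht
      have k1 := Sl_le h0 hW0 (s := p) (t := (p.1, y'')) (C := req (x'', y'')) (Or.inr rfl)
      have k2 := hWL (p.1, y'') (p.1, b)
      have k3 := hWL (p.1, b) (a, b)
      have k4 := abs_sub_le y'' b p.2
      rw [abs_sub_comm y'' b] at k4
      have k5 := mul_le_mul_of_nonneg_left k4 h0.le
      have k6 := mul_le_mul_of_nonneg_right h1.le (abs_nonneg (b - p.2))
      have k7 := mul_le_mul_of_nonneg_left hxy h0.le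
      simp only [dL1, sub_self, abs_zero, zero_add, add_zero] at h k1 k2 k3
      linarith
  set N := Sl lam W p (req (x'', y''))
  have hl : 0 < 1 - lam := by linarith
  have hκ : α * (1 - lam) / (1 + lam) * N ≤ α * (1 - lam) * D := by
    rw [div_mul_eq_mul_div, div_le_iff₀ (by linarith)]
    have := mul_le_mul_of_nonneg_left hN (mul_pos hα0 hl).le
    linarith
  have hκ2 : α * (1 - lam) / (1 + lam) * N ≤ α * N := by
    refine mul_le_mul_of_nonneg_right ?_ hp
    rw [div_le_iff₀ (by linarith)]
    nlinarith
  have hκ3 : α * (1 - lam) * D ≤ (1 - lam) / 4 * D := by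
    refine mul_le_mul_of_nonneg_right ?_ hD
    nlinarith
  rcases hVdec s1 with hs1 | hs1
  swap
  · obtain ⟨t1, t2, t3, h⟩ := caseA h0 h1 hα0 hα1 hV0 hWL hWV hVW s1 s2 s3 hs1
    exact ⟨t1, t2, t3, by linarith⟩
  rcases hVdec s2 with hs2 | hs2
  swap
  · obtain ⟨t1, t2, t3, h⟩ := caseA h0 h1 hα0 hα1 hV0 hWL hWV hVW s2 s1 s3 hs2
    rw [Gf_comm lam α V] at h
    exact ⟨t1, t2, t3, by linarith⟩
  rcases hVdec s3 with hs3 | hs3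
  swap
  · refine ⟨_, _, (x', s3.2), (caseBC h0 hα0 hα1 hV0 hVH s1 s2 s3 (x', s3.2) hs1 hs2
      ((1 - lam) * D) ?_).trans ?_⟩
    · have k4 := abs_sub_le x' x'' s3.1
      rw [abs_sub_comm x'' s3.1] at k4
      have k5 := mul_le_mul_of_nonneg_left k4 h0.le
      have k6 := mul_le_mul_of_nonneg_right h1.le (abs_nonneg (s3.1 - x''))
      simp only [dL1, sub_self, abs_zero, add_zero]
      linarith
    · linarith
  · obtain ⟨t1, t2, t3, h⟩ := horiz_case (x'' := x'') (y'' := y'') h0 hα0 hα2 hW0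
      s1.1 s2.1 s3.1 p
    refine ⟨t1, t2, t3, h.trans ?_⟩
    have := caseBC h0 hα0 hα1 hV0 hVH s1 s2 s3 (s3.1, y'') hs1 hs2 (-2 * δ) (by
      have k6 := mul_le_mul_of_nonneg_right h1.le (abs_nonneg (s3.2 - y''))
      simp only [dL1, sub_self, abs_zero, zero_add]
      rw [abs_sub_comm y'']
      linarith)
    have h9 := mul_le_mul_of_nonneg_right hα2 hδ
    linarith

end main

/-- There are constants `c₃, c₄ > 0` depending only on `λ` and `α` such that whenever the
request `r(x'',y'')` arrives after a sequence ending in `r(x',y')` (with `Δx ≥ Δy`) and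
`G_{W_{σ''}}` attains its infimum over `M³`, one has
`inf G_{W_{σ''}} − inf G_{W_{σ'}} ≥ c₃·∇ − c₄·Δy`. -/
theorem infG_increase (lam α : ℝ) (h0 : 0 < lam) (h1 : lam < 1)
    (hα0 : 0 < α) (hα1 : α ≤ (1 - lam) / (12 + 4 * lam)) :
    ∃ c3 : ℝ, 0 < c3 ∧ ∃ c4 : ℝ, 0 < c4 ∧
      ∀ (O : ℝ × ℝ) (l : List (ℝ × ℝ)) (x' y' x'' y'' : ℝ),
        |x' - x''| ≥ |y' - y''| →
        (∃ s1 s2 s3 : ℝ × ℝ, ∀ t1 t2 t3 : ℝ × ℝ,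
          Gf lam α (WF O (l ++ [(x', y'), (x'', y'')])) s1 s2 s3 ≤
            Gf lam α (WF O (l ++ [(x', y'), (x'', y'')])) t1 t2 t3) →
        infG lam α (WF O (l ++ [(x', y'), (x'', y'')])) -
            infG lam α (WF O (l ++ [(x', y')])) ≥
          c3 * sSup (Set.range fun s =>
              Sl lam (WF O (l ++ [(x', y')])) s (req (x'', y''))) -
            c4 * |y' - y''| := by
  have hα := alpha_bound h0 hα1
  have hc3 : 0 < α * (1 - lam) / (1 + lam) :=
    div_pos (mul_pos hα0 (by linarith)) (by linarith)
  refine ⟨α * (1 - lam) / (1 + lam), hc3, 4, by norm_num, ?_⟩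
  intro O l x' y' x'' y'' hxy _
  have happ : l ++ [(x', y'), (x'', y'')] = (l ++ [(x', y')]) ++ [(x'', y'')] := by simp
  rw [happ]
  set W := WF O (l ++ [(x', y')]) with hWdef
  set V := WF O ((l ++ [(x', y')]) ++ [(x'', y'')]) with hVdef
  have hge : ∀ s, dL1 O s ≤ W s := WF_ge _ O
  have hW0 : ∀ s, 0 ≤ W s := fun s => (dL1_nonneg O s).trans (hge s)
  have hWL : ∀ s t, W s ≤ W t + dL1 t s := WF_lip _ O
  have hWs : ∀ s, ∃ t ∈ req (x', y'), W t + dL1 t s ≤ W s := fun s => by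
    obtain ⟨t, ht, h⟩ := WF_snoc_attain O l (x', y') s
    refine ⟨t, ht, le_trans ?_ h⟩
    have := WF_snoc_le l (x', y') t t ht O
    have h0 : dL1 t t = 0 := by simp [dL1]
    rw [h0] at this
    rw [hWdef]
    linarith
  have hVle : ∀ s, ∀ t ∈ req (x'', y''), V s ≤ W t + dL1 t s :=
    fun s t ht => WF_snoc_le _ _ s t ht O
  have hVs : ∀ s, ∃ t ∈ req (x'', y''), W t + dL1 t s ≤ V s :=
    fun s => WF_snoc_attain O _ _ s
  have hinf : ∀ t1 t2 t3, infG lam α W ≤ Gf lam α W t1 t2 t3 := fun t1 t2 t3 => by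
    refine csInf_le ⟨0, ?_⟩ ⟨(t1, t2, t3), rfl⟩
    rintro _ ⟨q, rfl⟩
    exact Gf_nonneg h0 h1 hα0 hα hge _ _ _
  obtain ⟨p0, hp0, hmin⟩ := exists_min (x'', y'') O (continuous_of_lip hWL) hge
  have hN0 : 0 ≤ Sl lam W p0 (req (x'', y'')) := by
    refine le_Sl (req_nonempty _) fun t ht => ?_
    have := hmin t ht
    have := mul_nonneg h0.le (dL1_nonneg t p0)
    linarith
  have key : infG lam α W + α * (1 - lam) / (1 + lam) *
      sSup (Set.range fun s => Sl lam W s (req (x'', y''))) - 4 * |y' - y''| ≤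
      infG lam α V := by
    refine le_csInf (Set.range_nonempty _) ?_
    rintro _ ⟨⟨s1, s2, s3⟩, rfl⟩
    simp only
    have hpos : ∀ p, 0 ≤ Sl lam W p (req (x'', y'')) → Sl lam W p (req (x'', y'')) ≤
        (Gf lam α V s1 s2 s3 - infG lam α W + 4 * |y' - y''|) /
          (α * (1 - lam) / (1 + lam)) := fun p hp => by
      obtain ⟨t1, t2, t3, h⟩ := core h0 h1 hα0 hα hW0 hWL hWs hVle hVs hxy s1 s2 s3 p hp
      rw [le_div_iff₀ hc3]
      have := hinf t1 t2 t3
      linarith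
    have hsup : sSup (Set.range fun s => Sl lam W s (req (x'', y''))) ≤
        (Gf lam α V s1 s2 s3 - infG lam α W + 4 * |y' - y''|) /
          (α * (1 - lam) / (1 + lam)) := by
      refine csSup_le (Set.range_nonempty _) ?_
      rintro _ ⟨p, rfl⟩
      rcases le_total 0 (Sl lam W p (req (x'', y''))) with h | h
      · exact hpos p h
      · exact h.trans (hN0.trans (hpos p0 hN0))
    rw [le_div_iff₀ hc3] at hsup
    linarith
  linarith
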